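/- Let A and B be skew shapes. If Fsupp(A) = Fsupp(B), then rows_k(A) = rows_k(B) for all k ≥ 1, cols_ℓ(A) = cols_ℓ(B) for all ℓ ≥ 1, and rects_{k,ℓ}(A) = rects_{k,ℓ}(B) for all k, ℓ ≥ 1. -/

import Mathlib

namespace SkewPaper

open Finset

/-- A skew shape `λ/μ`, given by Young diagrams `μ ≤ λ`. -/
structure SkewShape where
  lam : YoungDiagram
  mu : YoungDiagram
  sub : mu ≤ lam

namespace SkewShape

/-- The cells (boxes) of the skew shape `λ/μ`. -/
def cells (A : SkewShape) : Finset (ℕ × ℕ) :=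
  A.lam.cells \ A.mu.cells

/-- The number of boxes of `A`. -/
def size (A : SkewShape) : ℕ := A.cells.card

end SkewShape

/-- The set of columns occupied by row `i` of the cell set `s`. -/
def rowCols (s : Finset (ℕ × ℕ)) (i : ℕ) : Finset ℕ :=
  (s.filter (fun c => c.1 = i)).image Prod.snd

/-- The set of rows occupied by column `j` of the cell set `s`. -/
def colRows (s : Finset (ℕ × ℕ)) (j : ℕ) : Finset ℕ :=
  (s.filter (fun c => c.2 = j)).image Prod.fst

/-- `overlapRow s k i` : the number of columns occupied in common by
rows `i, i+1, …, i+k-1` of `s`. -/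
def overlapRow (s : Finset (ℕ × ℕ)) (k i : ℕ) : ℕ :=
  ((rowCols s i).filter (fun j => ∀ t, t < k → j ∈ rowCols s (i + t))).card

/-- `overlapCol s l j` : the number of rows occupied in common by
columns `j, j+1, …, j+l-1` of `s`. -/
def overlapCol (s : Finset (ℕ × ℕ)) (l j : ℕ) : ℕ :=
  ((colRows s j).filter (fun i => ∀ t, t < l → i ∈ colRows s (j + t))).card

/-- `rows_k`: the partition (as the multiset of its nonzero parts) of overlaps of
`k` consecutive rows. -/
def rowsk (s : Finset (ℕ × ℕ)) (k : ℕ) : Multiset ℕ :=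
  ((s.image Prod.fst).val.map (overlapRow s k)).filter (fun m => 0 < m)

/-- `cols_l`: the partition (as the multiset of its nonzero parts) of overlaps of
`l` consecutive columns. -/
def colsk (s : Finset (ℕ × ℕ)) (l : ℕ) : Multiset ℕ :=
  ((s.image Prod.snd).val.map (overlapCol s l)).filter (fun m => 0 < m)

/-- `rects s k l`: the number of `k × l` rectangles of boxes contained inside `s`. -/
def rects (s : Finset (ℕ × ℕ)) (k l : ℕ) : ℕ :=
  (s.filter (fun c => ∀ a, a < k → ∀ b, b < l → (c.1 + a, c.2 + b) ∈ s)).card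

/-- The weakly decreasing sorted list of a multiset: the partition with those parts. -/
def sortDesc (s : Multiset ℕ) : List ℕ := (s.sort (· ≤ ·)).reverse

/-- Dominance order on partitions presented as multisets of parts:
every partial sum of the decreasing sort of `s` is at most the corresponding
partial sum for `t` (missing parts treated as `0`). -/
def Dom (s t : Multiset ℕ) : Prop :=
  ∀ j : ℕ, ((sortDesc s).take j).sum ≤ ((sortDesc t).take j).sum

/-- The conjugate (transpose) of a partition presented as a multiset of parts. -/
def conjM (s : Multiset ℕ) : Multiset ℕ :=
  (Multiset.range s.sup).map (fun j => Multiset.card (s.filter (fun x => j < x)))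

/-- A standard Young tableau of shape `A`: a bijective filling of the cells of `A`
by `1, …, |A|` which increases from left to right along rows and from top to
bottom down columns.  (Entries off the shape are normalized to `0`.) -/
structure SYT (A : SkewShape) where
  entry : ℕ × ℕ → ℕ
  zero_off : ∀ c, c ∉ A.cells → entry c = 0
  mem_range : ∀ c ∈ A.cells, entry c ∈ Finset.Icc 1 A.size
  injOn : Set.InjOn entry ↑A.cells
  row_lt : ∀ i j j', (i, j) ∈ A.cells → (i, j') ∈ A.cells → j < j' →
    entry (i, j) < entry (i, j')
  col_lt : ∀ i i' j, (i, j) ∈ A.cells → (i', j) ∈ A.cells → i < i' →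
    entry (i, j) < entry (i', j)

/-- The descent set of a standard Young tableau: those `k ∈ {1, …, n-1}` such that
`k+1` appears in a strictly lower row than `k`. -/
def SYT.descentSet {A : SkewShape} (T : SYT A) : Finset ℕ :=
  (Finset.Ico 1 A.size).filter (fun k =>
    ∃ c ∈ A.cells, ∃ c' ∈ A.cells, T.entry c = k ∧ T.entry c' = k + 1 ∧ c.1 < c'.1)

/-- The composition of `n` corresponding to a subset `D ⊆ {1, …, n-1}`:
its partial sums are the elements of `D`. -/
def compOfSet (n : ℕ) (D : Finset ℕ) : List ℕ :=
  if n = 0 then []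
  else
    let l := D.sort (· ≤ ·) ++ [n]
    List.zipWith (fun x y => x - y) l (0 :: l)

/-- The descent composition of a standard Young tableau. -/
def SYT.descentComp {A : SkewShape} (T : SYT A) : List ℕ :=
  compOfSet A.size T.descentSet

/-- The F-support of `A`: the set of descent compositions of SYT of shape `A`. -/
def Fsupp (A : SkewShape) : Set (List ℕ) :=
  {α | ∃ T : SYT A, T.descentComp = α}

/-- The number of standard Young tableaux of shape `A` with descent composition `α`. -/
noncomputable def countSYT (A : SkewShape) (α : List ℕ) : ℕ :=
  Nat.card {T : SYT A // T.descentComp = α}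

/-- `S(γ)`: the set of proper partial sums of the composition `γ`. -/
def Sset (γ : List ℕ) : Finset ℕ :=
  ((List.range (γ.length - 1)).map (fun j => (γ.take (j + 1)).sum)).toFinset

/-- `cols(α)` for a composition `α` of `n`, as a multiset: the parts of the
composition corresponding to the complement of `S(α)` in `{1, …, n-1}`. -/
def colsComp (α : List ℕ) : Multiset ℕ :=
  ↑(compOfSet α.sum ((Finset.Icc 1 (α.sum - 1)) \ Sset α))

/-- Delete the leftmost box of every nonempty row. -/
def trimCells (s : Finset (ℕ × ℕ)) : Finset (ℕ × ℕ) :=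
  s.filter (fun c => 1 ≤ c.2 ∧ (c.1, c.2 - 1) ∈ s)

/-- `s` is a ribbon whose (nonempty) rows are exactly rows `r0, …, r1`, with every
pair of adjacent rows overlapping in exactly one column. -/
def IsRibbonOn (s : Finset (ℕ × ℕ)) (r0 r1 : ℕ) : Prop :=
  r0 ≤ r1 ∧ (∀ i, (rowCols s i).Nonempty ↔ r0 ≤ i ∧ i ≤ r1) ∧
    (∀ i, r0 ≤ i → i < r1 → (rowCols s i ∩ rowCols s (i + 1)).card = 1)

/-- `A` is a ribbon. -/
def SkewShape.IsRibbon (A : SkewShape) : Prop :=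
  ∃ r0 r1, IsRibbonOn A.cells r0 r1

/-- An elongated ribbon: a ribbon all of whose rows have length at least two. -/
def ElongatedRibbon (A : SkewShape) : Prop :=
  A.IsRibbon ∧ ∀ i, (rowCols A.cells i).Nonempty → 2 ≤ (rowCols A.cells i).card

/-- A horizontal strip: at most one box in each column. -/
def IsHorizontalStrip (A : SkewShape) : Prop :=
  ∀ j, (colRows A.cells j).card ≤ 1

/-- `A` is F-multiplicity-free: distinct SYT of shape `A` have distinct descent sets. -/
def FMultFree (A : SkewShape) : Prop :=
  ∀ T T' : SYT A, T.descentSet = T'.descentSet → T = T'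

/-- The cells of a shape, viewed inside `ℤ × ℤ`. -/
def toZ (s : Finset (ℕ × ℕ)) : Finset (ℤ × ℤ) :=
  s.image (fun c => ((c.1 : ℤ), (c.2 : ℤ)))

/-- The cells of the hook `(m, 1^l)`. -/
def hookCells (m l : ℕ) : Finset (ℕ × ℕ) :=
  ((Finset.range m).image (fun j => ((0 : ℕ), j))) ∪
    ((Finset.Icc 1 l).image (fun i => (i, (0 : ℕ))))

namespace SkewShape

theorem mem_cells_iff (A : SkewShape) (i j : ℕ) :
    (i, j) ∈ A.cells ↔ A.mu.rowLen i ≤ j ∧ j < A.lam.rowLen i := by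
  simp [cells, YoungDiagram.mem_iff_lt_rowLen, and_comm]

theorem mem_cells_of_le_of_le {A : SkewShape} {i j i' j' i₀ j₀ : ℕ} (h : (i, j) ∈ A.cells)
    (h' : (i', j') ∈ A.cells) (hi : i ≤ i₀) (hi' : i₀ ≤ i') (hj : j ≤ j₀) (hj' : j₀ ≤ j') :
    (i₀, j₀) ∈ A.cells := by
  rw [mem_cells_iff] at *
  have h1 := A.mu.rowLen_anti i i₀ hi
  have h2 := A.lam.rowLen_anti i₀ i' hi'
  omega

/-- The transpose of a skew shape. -/
def transpose (A : SkewShape) : SkewShape where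
  lam := A.lam.transpose
  mu := A.mu.transpose
  sub := YoungDiagram.transpose_mono A.sub

theorem mem_cells_transpose (A : SkewShape) (i j : ℕ) :
    (i, j) ∈ A.transpose.cells ↔ (j, i) ∈ A.cells := by
  simp [cells, transpose, YoungDiagram.mem_transpose]

/-- The cells that are among the first `l` boxes of their row. -/
def rowInit (A : SkewShape) (l : ℕ) : Finset (ℕ × ℕ) :=
  A.cells.filter (fun c => c.2 < A.mu.rowLen c.1 + l)

/-- The cells that are among the first `m` boxes of their column, once the first `l` boxes
of every row have been removed. -/
def colInit (A : SkewShape) (l m : ℕ) : Finset (ℕ × ℕ) :=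
  A.cells.filter (fun c => A.mu.rowLen c.1 + l ≤ c.2 ∧
    ¬ (m ≤ c.1 ∧ A.mu.rowLen (c.1 - m) + l ≤ c.2))

/-- The number of boxes above the cell `c` in its column, once the first `l` boxes
of every row have been removed. -/
def depth (A : SkewShape) (l : ℕ) (c : ℕ × ℕ) : ℕ :=
  ((range c.1).filter (fun i => A.mu.rowLen i + l ≤ c.2)).card

theorem le_depth_iff (A : SkewShape) (l m : ℕ) (c : ℕ × ℕ) (h : A.mu.rowLen c.1 + l ≤ c.2) :
    m ≤ A.depth l c ↔ m ≤ c.1 ∧ A.mu.rowLen (c.1 - m) + l ≤ c.2 := by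
  constructor
  · intro hm
    by_contra hcon
    have hsub : (range c.1).filter (fun i => A.mu.rowLen i + l ≤ c.2) ⊆
        Ico (c.1 + 1 - m) c.1 := by
      intro i hi
      simp only [mem_filter, mem_range, mem_Ico] at hi ⊢
      refine ⟨?_, hi.1⟩
      by_contra hlt
      have := A.mu.rowLen_anti i (c.1 - m) (by omega)
      exact hcon ⟨by omega, by omega⟩
    have hcard := card_le_card hsub
    rw [Nat.card_Ico] at hcard
    have hm' : m ≤ c.1 + 1 - 1 := by
      have := card_le_card (filter_subset (fun i => A.mu.rowLen i + l ≤ c.2) (range c.1))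
      rw [card_range] at this
      unfold depth at hm
      omega
    unfold depth at hm
    have hm0 : m = 0 := by omega
    subst hm0
    exact hcon ⟨by omega, by simpa using h⟩
  · rintro ⟨hm, hl⟩
    have hsub : Ico (c.1 - m) c.1 ⊆ (range c.1).filter (fun i => A.mu.rowLen i + l ≤ c.2) := by
      intro i hi
      simp only [mem_filter, mem_range, mem_Ico] at hi ⊢
      have := A.mu.rowLen_anti (c.1 - m) i hi.1
      omega
    have hcard := card_le_card hsub
    rw [Nat.card_Ico] at hcard
    unfold depth
    omega

theorem mem_colInit_iff (A : SkewShape) (l m : ℕ) (c : ℕ × ℕ) :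
    c ∈ A.colInit l m ↔ c ∈ A.cells ∧ A.mu.rowLen c.1 + l ≤ c.2 ∧ A.depth l c < m := by
  simp only [colInit, mem_filter]
  refine and_congr_right fun _ => and_congr_right fun h => ?_
  rw [← A.le_depth_iff l m c h, not_le]

theorem depth_mono (A : SkewShape) (l : ℕ) {c c' : ℕ × ℕ} (h : c ≤ c') :
    A.depth l c ≤ A.depth l c' := by
  refine card_le_card fun i hi => ?_
  simp only [mem_filter, mem_range] at hi ⊢
  exact ⟨hi.1.trans_le h.1, hi.2.trans h.2⟩

theorem depth_lt (A : SkewShape) {l : ℕ} {c c' : ℕ × ℕ} (h : c.1 < c'.1) (h' : c.2 ≤ c'.2)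
    (hl : A.mu.rowLen c.1 + l ≤ c.2) : A.depth l c < A.depth l c' := by
  refine card_lt_card ((ssubset_iff_of_subset fun i hi => ?_).2 ⟨c.1, ?_, ?_⟩)
  · simp only [mem_filter, mem_range] at hi ⊢
    exact ⟨hi.1.trans h, hi.2.trans h'⟩
  · simp only [mem_filter, mem_range]
    exact ⟨h, hl.trans h'⟩
  · simp

/-- A rectangle of `A` is counted by its bottom right corner. -/
theorem rects_succ_succ (A : SkewShape) (m l : ℕ) :
    rects A.cells (m + 1) (l + 1) = (A.cells.filter (fun c => A.mu.rowLen c.1 + l ≤ c.2 ∧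
      (m ≤ c.1 ∧ A.mu.rowLen (c.1 - m) + l ≤ c.2))).card := by
  refine card_bij (fun c _ => (c.1 + m, c.2 + l)) ?_ ?_ ?_
  · rintro ⟨i, j⟩ h
    simp only [mem_filter] at h ⊢
    have h1 := h.2 m (by omega) l (by omega)
    have h2 := h.1
    have h3 := A.mu.rowLen_anti i (i + m) (by omega)
    rw [mem_cells_iff] at h2
    refine ⟨h1, ?_⟩
    rw [Nat.add_sub_cancel]
    omega
  · rintro ⟨i, j⟩ _ ⟨i', j'⟩ _ h
    simp only [Prod.mk.injEq] at h ⊢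
    omega
  · rintro ⟨i, j⟩ h
    simp only [mem_filter] at h
    obtain ⟨h1, h2, h3, h4⟩ := h
    have h5 := (A.mem_cells_iff i j).1 h1
    have h6 := A.lam.rowLen_anti (i - m) i (by omega)
    have h7 : (i - m, j - l) ∈ A.cells := by
      rw [mem_cells_iff]
      omega
    refine ⟨(i - m, j - l), ?_, by simp only [Prod.mk.injEq]; omega⟩
    simp only [mem_filter]
    exact ⟨h7, fun a ha b hb => mem_cells_of_le_of_le h7 h1 (by omega) (by omega) (by omega)
      (by omega)⟩

theorem rects_add_card (A : SkewShape) (m l : ℕ) :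
    rects A.cells (m + 1) (l + 1) + (A.colInit l m).card + (A.rowInit l).card = A.size := by
  rw [rects_succ_succ, colInit, rowInit, size,
    ← card_filter_add_card_filter_not (s := A.cells) (fun c => A.mu.rowLen c.1 + l ≤ c.2),
    ← card_filter_add_card_filter_not
      (s := A.cells.filter (fun c => A.mu.rowLen c.1 + l ≤ c.2))
      (fun c => m ≤ c.1 ∧ A.mu.rowLen (c.1 - m) + l ≤ c.2)]
  simp only [filter_filter, not_le]

theorem mem_rowCols (s : Finset (ℕ × ℕ)) (i j : ℕ) : j ∈ rowCols s i ↔ (i, j) ∈ s := by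
  simp [rowCols]

theorem mem_colRows (s : Finset (ℕ × ℕ)) (i j : ℕ) : i ∈ colRows s j ↔ (i, j) ∈ s := by
  simp [colRows]

theorem overlapRow_succ (A : SkewShape) (k i : ℕ) :
    overlapRow A.cells (k + 1) i = A.lam.rowLen (i + k) - A.mu.rowLen i := by
  rw [overlapRow, ← Nat.card_Ico]
  congr 1
  ext j
  simp only [mem_filter, mem_rowCols, mem_Ico]
  constructor
  · rintro ⟨h1, h2⟩
    exact ⟨((A.mem_cells_iff _ _).1 h1).1, ((A.mem_cells_iff _ _).1 (h2 k (by omega))).2⟩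
  · rintro ⟨h1, h2⟩
    have h : ∀ t, t < k + 1 → (i + t, j) ∈ A.cells := by
      intro t ht
      have h3 := A.mu.rowLen_anti i (i + t) (by omega)
      have h4 := A.lam.rowLen_anti (i + t) (i + k) (by omega)
      rw [mem_cells_iff]
      omega
    exact ⟨h 0 (by omega), h⟩

theorem rects_eq_sum (A : SkewShape) (k l : ℕ) :
    rects A.cells (k + 1) (l + 1) =
      ∑ i ∈ A.cells.image Prod.fst, (overlapRow A.cells (k + 1) i - l) := by
  rw [rects, card_eq_sum_card_fiberwise (f := Prod.fst) (t := A.cells.image Prod.fst)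
    (fun c hc => mem_image_of_mem _ (mem_filter.1 hc).1)]
  refine sum_congr rfl fun i _ => ?_
  rw [overlapRow_succ, Nat.sub_right_comm, ← Nat.card_Ico]
  refine card_bij (fun c _ => c.2) ?_ ?_ ?_
  · rintro ⟨i', j⟩ h
    simp only [mem_filter, mem_Ico] at h ⊢
    obtain ⟨⟨h1, h2⟩, rfl⟩ := h
    have h3 := (A.mem_cells_iff _ _).1 (h2 k (by omega) l (by omega))
    have h4 := (A.mem_cells_iff _ _).1 h1
    omega
  · rintro ⟨i₁, j₁⟩ h₁ ⟨i₂, j₂⟩ h₂ h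
    simp only [mem_filter] at h₁ h₂ h
    rw [h₁.2, h₂.2, h]
  · intro j hj
    rw [mem_Ico] at hj
    have h : ∀ a, a < k + 1 → ∀ b, b < l + 1 → (i + a, j + b) ∈ A.cells := by
      intro a ha b hb
      have h3 := A.mu.rowLen_anti i (i + a) (by omega)
      have h4 := A.lam.rowLen_anti (i + a) (i + k) (by omega)
      rw [mem_cells_iff]
      omega
    exact ⟨(i, j), mem_filter.2 ⟨mem_filter.2 ⟨h 0 (by omega) 0 (by omega), h⟩, rfl⟩, rfl⟩

end SkewShape

/-- The positive parts of a multiset `s` of natural numbers are determined by the sums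
`∑ x ∈ s, (x - l)` of truncated differences. -/
theorem filter_pos_eq_of_sum_sub_eq {s t : Multiset ℕ}
    (h : ∀ l, (s.map (fun x => x - l)).sum = (t.map (fun x => x - l)).sum) :
    s.filter (fun x => 0 < x) = t.filter (fun x => 0 < x) := by
  have key : ∀ (u : Multiset ℕ) (x : ℕ), (u.map (fun y => y - x)).sum +
      (u.map (fun y => y - (x + 2))).sum =
      2 * (u.map (fun y => y - (x + 1))).sum + u.count (x + 1) := by
    intro u x
    induction u using Multiset.induction_on with
    | empty => simp
    | cons a u ih =>
      simp only [Multiset.map_cons, Multiset.sum_cons, Multiset.count_cons]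
      split_ifs <;> omega
  ext x
  rw [Multiset.count_filter, Multiset.count_filter]
  split_ifs with hx
  · obtain ⟨x, rfl⟩ : ∃ y, x = y + 1 := ⟨x - 1, by omega⟩
    have h1 := key s x
    have h2 := key t x
    rw [h, h, h] at h1
    omega
  · rfl

namespace SkewShape

theorem rowsk_eq_of_rects_eq {A B : SkewShape}
    (h : ∀ k l, 1 ≤ k → 1 ≤ l → rects A.cells k l = rects B.cells k l) (k : ℕ) (hk : 1 ≤ k) :
    rowsk A.cells k = rowsk B.cells k := by
  obtain ⟨k, rfl⟩ : ∃ y, k = y + 1 := ⟨k - 1, by omega⟩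
  refine filter_pos_eq_of_sum_sub_eq fun l => ?_
  have := h (k + 1) (l + 1) (by omega) (by omega)
  rw [rects_eq_sum, rects_eq_sum] at this
  simpa [Finset.sum, Multiset.map_map] using this

theorem rects_transpose (A : SkewShape) (k l : ℕ) :
    rects A.transpose.cells k l = rects A.cells l k := by
  refine card_bij (fun c _ => c.swap) ?_ (fun _ _ _ _ h => Prod.swap_injective h) ?_
  · rintro ⟨i, j⟩ h
    simp only [mem_filter, mem_cells_transpose, Prod.swap] at h ⊢
    exact ⟨h.1, fun a ha b hb => h.2 b hb a ha⟩
  · rintro ⟨i, j⟩ h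
    refine ⟨(j, i), ?_, rfl⟩
    simp only [mem_filter, mem_cells_transpose] at h ⊢
    exact ⟨h.1, fun a ha b hb => h.2 b hb a ha⟩

theorem rowsk_transpose (A : SkewShape) (k : ℕ) :
    rowsk A.transpose.cells k = colsk A.cells k := by
  have h1 : A.transpose.cells.image Prod.fst = A.cells.image Prod.snd := by
    ext i
    simp [mem_cells_transpose]
  have h2 : ∀ i, rowCols A.transpose.cells i = colRows A.cells i := by
    intro i
    ext j
    rw [mem_rowCols, mem_colRows, mem_cells_transpose]
  have h3 : overlapRow A.transpose.cells k = overlapCol A.cells k := by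
    funext i
    simp only [overlapRow, overlapCol, h2]
  rw [rowsk, colsk, h1, h3]

end SkewShape

namespace SYT

variable {A : SkewShape} (T : SYT A)

theorem image_entry : A.cells.image T.entry = Icc 1 A.size := by
  refine eq_of_subset_of_card_le (image_subset_iff.2 T.mem_range) ?_
  rw [card_image_of_injOn T.injOn, Nat.card_Icc]
  exact le_rfl

theorem exists_entry_eq {k : ℕ} (hk : k ∈ Icc 1 A.size) : ∃ c ∈ A.cells, T.entry c = k := by
  rw [← T.image_entry] at hk
  simpa using hk

theorem card_entry_mem (I : Finset ℕ) (hI : I ⊆ Icc 1 A.size) :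
    (A.cells.filter (fun c => T.entry c ∈ I)).card = I.card := by
  have : (A.cells.filter (fun c => T.entry c ∈ I)).image T.entry = I := by
    ext k
    simp only [mem_image, mem_filter]
    constructor
    · rintro ⟨c, hc, rfl⟩
      exact hc.2
    · intro hk
      obtain ⟨c, hc, rfl⟩ := T.exists_entry_eq (hI hk)
      exact ⟨c, ⟨hc, hk⟩, rfl⟩
  conv_rhs => rw [← this]
  exact (card_image_of_injOn (T.injOn.mono (coe_subset.2 (filter_subset _ _)))).symm

theorem mem_descentSet_iff {c c' : ℕ × ℕ} (hc : c ∈ A.cells) (hc' : c' ∈ A.cells)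
    (h : T.entry c' = T.entry c + 1) : T.entry c ∈ T.descentSet ↔ c.1 < c'.1 := by
  have h1 := mem_Icc.1 (T.mem_range c hc)
  have h2 := mem_Icc.1 (T.mem_range c' hc')
  simp only [descentSet, mem_filter, mem_Ico]
  constructor
  · rintro ⟨-, d, hd, d', hd', h3, h4, h5⟩
    rwa [← T.injOn hd hc h3, ← T.injOn hd' hc' (h4.trans h.symm)]
  · exact fun hlt => ⟨by omega, c, hc, c', hc', rfl, h, hlt⟩

theorem fst_le_of_forall_notMem {c c' : ℕ × ℕ} (hc : c ∈ A.cells) (hc' : c' ∈ A.cells)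
    (hle : T.entry c ≤ T.entry c')
    (h : ∀ k ∈ Ico (T.entry c) (T.entry c'), k ∉ T.descentSet) : c'.1 ≤ c.1 := by
  obtain ⟨d, hd⟩ := Nat.exists_eq_add_of_le hle
  induction d generalizing c' with
  | zero => rw [T.injOn hc' hc (by simpa using hd)]
  | succ d ih =>
    have h1 := mem_Icc.1 (T.mem_range c hc)
    have h2 := mem_Icc.1 (T.mem_range c' hc')
    obtain ⟨e, he, hee⟩ := T.exists_entry_eq (k := T.entry c + d)
      (mem_Icc.2 ⟨by omega, by omega⟩)
    have h3 := ih he (by omega) (fun k hk => h k (by rw [mem_Ico] at *; omega)) hee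
    have h4 := h (T.entry e) (by rw [mem_Ico]; omega)
    rw [T.mem_descentSet_iff he hc' (by omega)] at h4
    omega

theorem fst_add_le_of_forall_mem {c c' : ℕ × ℕ} (hc : c ∈ A.cells) (hc' : c' ∈ A.cells)
    {d : ℕ} (hd : T.entry c' = T.entry c + d)
    (h : ∀ k ∈ Ico (T.entry c) (T.entry c'), k ∈ T.descentSet) : c.1 + d ≤ c'.1 := by
  induction d generalizing c' with
  | zero => rw [T.injOn hc' hc (by simpa using hd)]; rfl
  | succ d ih =>
    have h1 := mem_Icc.1 (T.mem_range c hc)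
    have h2 := mem_Icc.1 (T.mem_range c' hc')
    obtain ⟨e, he, hee⟩ := T.exists_entry_eq (k := T.entry c + d)
      (mem_Icc.2 ⟨by omega, by omega⟩)
    have h3 := ih he hee (fun k hk => h k (by rw [mem_Ico] at *; omega))
    have h4 := h (T.entry e) (by rw [mem_Ico]; omega)
    rw [T.mem_descentSet_iff he hc' (by omega)] at h4
    omega

end SYT

/-- The first `N` letters of a word with descent set `D` split into at most `l` runs of
consecutive descents. -/
def InitDescending (D : Finset ℕ) (l N : ℕ) : Prop :=
  ∀ k ∈ Icc 1 N, (Ico 1 k \ D).card < l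

/-- The `M` letters following the first `N` letters of a word with descent set `D` split into at
most `m` runs without descents. -/
def NextAscending (D : Finset ℕ) (N m M : ℕ) : Prop :=
  ∀ k ∈ Icc (N + 1) (N + M), (Ico (N + 1) k ∩ D).card < m

namespace SYT

variable {A : SkewShape} (T : SYT A)

theorem exists_notMem_descentSet {i j : ℕ} (h : (i, j) ∈ A.cells) (h' : (i, j + 1) ∈ A.cells) :
    ∃ k ∈ Ico (T.entry (i, j)) (T.entry (i, j + 1)), k ∉ T.descentSet := by
  by_contra! hcon
  have hlt := T.row_lt i j (j + 1) h h' (by omega)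
  have := T.fst_add_le_of_forall_mem h h' (d := T.entry (i, j + 1) - T.entry (i, j)) (by omega) hcon
  dsimp only at this
  omega

theorem exists_mem_descentSet {i j : ℕ} (h : (i, j) ∈ A.cells) (h' : (i + 1, j) ∈ A.cells) :
    ∃ k ∈ Ico (T.entry (i, j)) (T.entry (i + 1, j)), k ∈ T.descentSet := by
  by_contra! hcon
  have hlt := T.col_lt i (i + 1) j h h' (by omega)
  have := T.fst_le_of_forall_notMem h h' hlt.le hcon
  dsimp only at this
  omega

theorem le_card_sdiff_descentSet {i j l : ℕ} (h : (i, j) ∈ A.cells) (h' : (i, j + l) ∈ A.cells) :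
    l ≤ (Ico 1 (T.entry (i, j + l)) \ T.descentSet).card := by
  induction l with
  | zero => omega
  | succ l ih =>
    have hm := SkewShape.mem_cells_of_le_of_le h h' le_rfl le_rfl
      (show j ≤ j + l by omega) (by omega)
    obtain ⟨k, hk, hkD⟩ := T.exists_notMem_descentSet hm h'
    have h1 := mem_Icc.1 (T.mem_range _ hm)
    rw [mem_Ico] at hk
    refine (ih hm).trans_lt (card_lt_card ?_)
    refine (ssubset_iff_of_subset ?_).2 ⟨k, ?_, ?_⟩
    · refine sdiff_subset_sdiff (Ico_subset_Ico_right ?_) le_rfl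
      exact (T.row_lt i _ _ hm h' (by omega)).le
    · simp only [mem_sdiff, mem_Ico]
      exact ⟨⟨by omega, hk.2⟩, hkD⟩
    · simp only [mem_sdiff, mem_Ico]
      omega

theorem le_card_inter_descentSet {i j m N : ℕ} (h : (i, j) ∈ A.cells)
    (h' : (i + m, j) ∈ A.cells) (hN : N ≤ T.entry (i, j)) :
    m ≤ (Ico N (T.entry (i + m, j)) ∩ T.descentSet).card := by
  induction m with
  | zero => omega
  | succ m ih =>
    have hm := SkewShape.mem_cells_of_le_of_le h h' (show i ≤ i + m by omega) (by omega)
      le_rfl le_rfl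
    obtain ⟨k, hk, hkD⟩ := T.exists_mem_descentSet hm h'
    have h1 : T.entry (i, j) ≤ T.entry (i + m, j) := by
      rcases Nat.eq_zero_or_pos m with rfl | hpos
      · rfl
      · exact (T.col_lt _ _ _ h hm (by omega)).le
    rw [mem_Ico] at hk
    refine (ih hm).trans_lt (card_lt_card ?_)
    refine (ssubset_iff_of_subset ?_).2 ⟨k, ?_, ?_⟩
    · refine inter_subset_inter (Ico_subset_Ico_right ?_) le_rfl
      exact (T.col_lt _ _ j hm h' (by omega)).le
    · simp only [mem_inter, mem_Ico]
      exact ⟨⟨by omega, hk.2⟩, hkD⟩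
    · simp only [mem_inter, mem_Ico]
      omega

theorem filter_entry_le_subset_rowInit {l N : ℕ} (h : InitDescending T.descentSet l N) :
    A.cells.filter (fun c => T.entry c ∈ Icc 1 N) ⊆ A.rowInit l := by
  rintro ⟨i, j⟩ hc
  rw [mem_filter] at hc
  simp only [SkewShape.rowInit, mem_filter]
  refine ⟨hc.1, ?_⟩
  by_contra! hcon
  obtain ⟨j, rfl⟩ := Nat.exists_eq_add_of_le' ((Nat.le_add_left l _).trans hcon)
  have h1 := (A.mem_cells_iff _ _).1 hc.1
  have h2 : (i, j) ∈ A.cells := by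
    rw [SkewShape.mem_cells_iff]
    omega
  exact (h _ hc.2).not_ge (T.le_card_sdiff_descentSet h2 hc.1)

theorem le_card_rowInit {l N : ℕ} (hN : N ≤ A.size) (h : InitDescending T.descentSet l N) :
    N ≤ (A.rowInit l).card := by
  have h1 := card_le_card (T.filter_entry_le_subset_rowInit h)
  rwa [T.card_entry_mem _ (Icc_subset_Icc_right hN), Nat.card_Icc, Nat.add_sub_cancel] at h1

theorem le_card_colInit {l m M : ℕ} (hM : (A.rowInit l).card + M ≤ A.size)
    (h : InitDescending T.descentSet l (A.rowInit l).card)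
    (h' : NextAscending T.descentSet (A.rowInit l).card m M) :
    M ≤ (A.colInit l m).card := by
  have heq : A.cells.filter (fun c => T.entry c ∈ Icc 1 (A.rowInit l).card) = A.rowInit l := by
    refine eq_of_subset_of_card_le (T.filter_entry_le_subset_rowInit h) ?_
    rw [T.card_entry_mem _ (Icc_subset_Icc_right (by omega)), Nat.card_Icc, Nat.add_sub_cancel]
  have hmem : ∀ c ∈ A.cells, (T.entry c ≤ (A.rowInit l).card ↔
      c.2 < A.mu.rowLen c.1 + l) := by
    intro c hc
    have h1 := mem_Icc.1 (T.mem_range c hc)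
    have h2 : c ∈ A.cells.filter (fun c => T.entry c ∈ Icc 1 (A.rowInit l).card) ↔
      c ∈ A.rowInit l := by rw [heq]
    simpa [SkewShape.rowInit, hc, h1.1] using h2
  have hsub : A.cells.filter (fun c => T.entry c ∈
      Icc ((A.rowInit l).card + 1) ((A.rowInit l).card + M)) ⊆ A.colInit l m := by
    rintro ⟨i, j⟩ hc
    rw [mem_filter] at hc
    have h3 := hmem _ hc.1
    have h4 := mem_Icc.1 hc.2
    have h5 := (A.mem_cells_iff _ _).1 hc.1
    simp only [SkewShape.colInit, mem_filter]
    refine ⟨hc.1, by dsimp only at h3; omega, ?_⟩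
    rintro ⟨h6, h7⟩
    obtain ⟨i, rfl⟩ := Nat.exists_eq_add_of_le' h6
    rw [Nat.add_sub_cancel] at h7
    have h8 := A.lam.rowLen_anti i (i + m) (by omega)
    have h9 : (i, j) ∈ A.cells := by
      rw [SkewShape.mem_cells_iff]
      omega
    have h10 := hmem _ h9
    refine (h' _ hc.2).not_ge (T.le_card_inter_descentSet h9 hc.1 ?_)
    dsimp only at h10
    omega
  have h1 := card_le_card hsub
  rw [T.card_entry_mem _ (Icc_subset_Icc (by omega) hM), Nat.card_Icc] at h1
  omega

/-- The standard Young tableau that fills the cells in the order of their keys. -/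
def ofKey {α : Type*} [LinearOrder α] (A : SkewShape) (f : ℕ × ℕ → α)
    (hinj : Set.InjOn f ↑A.cells)
    (hlt : ∀ c ∈ A.cells, ∀ c' ∈ A.cells, c < c' → f c < f c') : SYT A :=
  have key : ∀ c ∈ A.cells, ∀ c' ∈ A.cells, f c < f c' →
      (A.cells.filter (fun d => f d ≤ f c)).card < (A.cells.filter (fun d => f d ≤ f c')).card := by
    intro c _ c' hc' hcc'
    refine card_lt_card ((ssubset_iff_of_subset ?_).2 ⟨c', ?_, ?_⟩)
    · exact monotone_filter_right _ fun d _ (hd : f d ≤ f c) => hd.trans hcc'.le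
    · simp [hc']
    · simp [hcc']
  { entry := fun c => if c ∈ A.cells then (A.cells.filter (fun d => f d ≤ f c)).card else 0
    zero_off := fun c hc => if_neg hc
    mem_range := fun c hc => by
      rw [if_pos hc, mem_Icc]
      exact ⟨card_pos.2 ⟨c, by simp [hc]⟩, card_filter_le _ _⟩
    injOn := fun c hc c' hc' h => by
      rw [mem_coe] at hc hc'
      simp only [if_pos hc, if_pos hc'] at h
      rcases lt_trichotomy (f c) (f c') with hlt | heq | hlt
      · exact absurd h (key _ hc _ hc' hlt).ne
      · exact hinj hc hc' heq
      · exact absurd h (key _ hc' _ hc hlt).ne'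
    row_lt := fun i j j' h h' hj => by
      rw [if_pos h, if_pos h']
      exact key _ h _ h' (hlt _ h _ h' (Prod.mk_lt_mk_iff_right.2 hj))
    col_lt := fun i i' j h h' hi => by
      rw [if_pos h, if_pos h']
      exact key _ h _ h' (hlt _ h _ h' (Prod.mk_lt_mk_iff_left.2 hi)) }

theorem ofKey_entry {α : Type*} [LinearOrder α] (A : SkewShape) (f : ℕ × ℕ → α)
    (hinj : Set.InjOn f ↑A.cells)
    (hlt : ∀ c ∈ A.cells, ∀ c' ∈ A.cells, c < c' → f c < f c') {c : ℕ × ℕ} (hc : c ∈ A.cells) :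
    (ofKey A f hinj hlt).entry c = (A.cells.filter (fun d => f d ≤ f c)).card :=
  if_pos hc

theorem ofKey_entry_le_iff {α : Type*} [LinearOrder α] (A : SkewShape) (f : ℕ × ℕ → α)
    (hinj : Set.InjOn f ↑A.cells)
    (hlt : ∀ c ∈ A.cells, ∀ c' ∈ A.cells, c < c' → f c < f c') {c c' : ℕ × ℕ}
    (hc : c ∈ A.cells) (hc' : c' ∈ A.cells) :
    (ofKey A f hinj hlt).entry c ≤ (ofKey A f hinj hlt).entry c' ↔ f c ≤ f c' := by
  rw [ofKey_entry A f hinj hlt hc, ofKey_entry A f hinj hlt hc']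
  constructor
  · intro h
    by_contra! hcon
    refine h.not_gt (card_lt_card ((ssubset_iff_of_subset ?_).2 ⟨c, ?_, ?_⟩))
    · exact monotone_filter_right _ fun d _ (hd : f d ≤ f c') => hd.trans hcon.le
    · simp [hc]
    · simp [hcon]
  · intro h
    exact card_le_card (monotone_filter_right _ fun d _ (hd : f d ≤ f c) => hd.trans h)

/-- If the cells of `S` come first in `T`, then they are filled with `1, …, |S|`. -/
theorem entry_le_card_iff {S : Finset (ℕ × ℕ)} (hS : S ⊆ A.cells)
    (h : ∀ c ∈ S, ∀ c' ∈ A.cells, T.entry c' ≤ T.entry c → c' ∈ S) {c : ℕ × ℕ}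
    (hc : c ∈ A.cells) : T.entry c ≤ S.card ↔ c ∈ S := by
  have h1 := mem_Icc.1 (T.mem_range c hc)
  have h2 := T.card_entry_mem (Icc 1 (T.entry c)) (Icc_subset_Icc_right h1.2)
  rw [Nat.card_Icc, Nat.add_sub_cancel] at h2
  constructor
  · intro hle
    by_contra hcS
    refine hle.not_gt ?_
    rw [← h2]
    refine card_lt_card ((ssubset_iff_of_subset ?_).2 ⟨c, ?_, hcS⟩)
    · intro d hd
      have h3 := mem_Icc.1 (T.mem_range d (hS hd))
      simp only [mem_filter, mem_Icc]
      refine ⟨hS hd, h3.1, ?_⟩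
      by_contra! hlt
      exact hcS (h d hd c hc hlt.le)
    · simp [hc, h1.1]
  · intro hcS
    rw [← h2]
    refine card_le_card fun d hd => ?_
    simp only [mem_filter, mem_Icc] at hd
    exact h c hcS d hd.1 hd.2.2

end SYT

/-- A statistic which is monotone on `[a, k]` and increases at every step in `S` ends with a value
of at least `|S|`. -/
theorem card_lt_of_forall_lt_succ {g : ℕ → ℕ} {a k l : ℕ} {S : Finset ℕ} (hS : S ⊆ Ico a k)
    (hmono : ∀ x ∈ Ico a k, g x ≤ g (x + 1)) (hstep : ∀ x ∈ S, g x < g (x + 1)) (hak : a ≤ k)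
    (hk : g k < l) : S.card < l := by
  refine lt_of_le_of_lt ?_ hk
  induction k, hak using Nat.le_induction generalizing S l with
  | base =>
    rw [Ico_self, subset_empty] at hS
    simp [hS]
  | succ k hak ih =>
    have h1 := ih (S := S.erase k) (l := g k + 1) (fun x hx => by
        have := mem_Ico.1 (hS (mem_of_mem_erase hx))
        have := ne_of_mem_erase hx
        rw [mem_Ico]
        omega)
      (fun x hx => hmono x (by rw [mem_Ico] at *; omega))
      (fun x hx => hstep x (mem_of_mem_erase hx)) (by omega)
    by_cases hkS : k ∈ S
    · have := hstep k hkS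
      rw [card_erase_of_mem hkS] at h1
      omega
    · have := hmono k (by rw [mem_Ico]; omega)
      rw [erase_eq_of_notMem hkS] at h1
      omega

namespace SYT

/-- The key of the tableau which is filled first along the initial `l` boxes of the rows, one
vertical strip at a time, and then one horizontal strip at a time. -/
def layerKey (A : SkewShape) (l : ℕ) (c : ℕ × ℕ) : ℕ ×ₗ ℕ ×ₗ ℕ :=
  if c.2 < A.mu.rowLen c.1 + l then toLex (0, toLex (c.2 - A.mu.rowLen c.1, c.1))
  else toLex (1, toLex (A.depth l c, c.2))

theorem layerKey_lt_iff_of_lt_of_lt (A : SkewShape) (l : ℕ) {c c' : ℕ × ℕ}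
    (h : c.2 < A.mu.rowLen c.1 + l) (h' : c'.2 < A.mu.rowLen c'.1 + l) :
    layerKey A l c < layerKey A l c' ↔
      c.2 - A.mu.rowLen c.1 < c'.2 - A.mu.rowLen c'.1 ∨
        c.2 - A.mu.rowLen c.1 = c'.2 - A.mu.rowLen c'.1 ∧ c.1 < c'.1 := by
  simp [layerKey, h, h', Prod.Lex.toLex_lt_toLex]

theorem layerKey_lt_iff_of_le_of_le (A : SkewShape) (l : ℕ) {c c' : ℕ × ℕ}
    (h : A.mu.rowLen c.1 + l ≤ c.2) (h' : A.mu.rowLen c'.1 + l ≤ c'.2) :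
    layerKey A l c < layerKey A l c' ↔
      A.depth l c < A.depth l c' ∨ A.depth l c = A.depth l c' ∧ c.2 < c'.2 := by
  simp [layerKey, h.not_gt, h'.not_gt, Prod.Lex.toLex_lt_toLex]

theorem layerKey_lt_of_lt_of_le (A : SkewShape) (l : ℕ) {c c' : ℕ × ℕ}
    (h : c.2 < A.mu.rowLen c.1 + l) (h' : A.mu.rowLen c'.1 + l ≤ c'.2) :
    layerKey A l c < layerKey A l c' := by
  simp [layerKey, h, h'.not_gt, Prod.Lex.toLex_lt_toLex]

theorem layerKey_lt (A : SkewShape) (l : ℕ) {c c' : ℕ × ℕ} (hc : c ∈ A.cells)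
    (hc' : c' ∈ A.cells) (h : c < c') : layerKey A l c < layerKey A l c' := by
  have h1 := (A.mem_cells_iff _ _).1 hc
  have h2 := (A.mem_cells_iff _ _).1 hc'
  have h3 := A.mu.rowLen_anti _ _ h.le.1
  have h4 := h.le.2
  have h5 := Prod.lt_iff.1 h
  rcases lt_or_ge c.2 (A.mu.rowLen c.1 + l) with hl | hl
  · rcases lt_or_ge c'.2 (A.mu.rowLen c'.1 + l) with hl' | hl'
    · rw [layerKey_lt_iff_of_lt_of_lt A l hl hl']
      omega
    · exact layerKey_lt_of_lt_of_le A l hl hl'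
  · have hl' : A.mu.rowLen c'.1 + l ≤ c'.2 := by omega
    rw [layerKey_lt_iff_of_le_of_le A l hl hl']
    rcases h.le.1.lt_or_eq with hr | hr
    · exact Or.inl (A.depth_lt hr h4 hl)
    · have := A.depth_mono l h.le
      omega

theorem layerKey_injOn (A : SkewShape) (l : ℕ) : Set.InjOn (layerKey A l) ↑A.cells := by
  intro c hc c' hc' h
  have h1 := (A.mem_cells_iff _ _).1 (mem_coe.1 hc)
  have h2 := (A.mem_cells_iff _ _).1 (mem_coe.1 hc')
  have h3 := h.not_lt
  have h4 := h.not_gt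
  rcases lt_or_ge c.2 (A.mu.rowLen c.1 + l) with hl | hl <;>
    rcases lt_or_ge c'.2 (A.mu.rowLen c'.1 + l) with hl' | hl'
  · rw [layerKey_lt_iff_of_lt_of_lt A l hl hl'] at h3
    rw [layerKey_lt_iff_of_lt_of_lt A l hl' hl] at h4
    have h5 : c.1 = c'.1 := by omega
    rw [h5] at h1 h3 h4
    exact Prod.ext h5 (by omega)
  · exact absurd (layerKey_lt_of_lt_of_le A l hl hl') h3
  · exact absurd (layerKey_lt_of_lt_of_le A l hl' hl) h4
  · rw [layerKey_lt_iff_of_le_of_le A l hl hl'] at h3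
    rw [layerKey_lt_iff_of_le_of_le A l hl' hl] at h4
    have h5 : c.2 = c'.2 := by omega
    refine Prod.ext ?_ h5
    rcases lt_trichotomy c.1 c'.1 with hr | hr | hr
    · have := A.depth_lt hr h5.le hl
      omega
    · exact hr
    · have := A.depth_lt hr h5.ge hl'
      omega

theorem exists_layered (A : SkewShape) (l : ℕ) : ∃ T : SYT A,
    InitDescending T.descentSet l (A.rowInit l).card ∧
    ∀ m, NextAscending T.descentSet (A.rowInit l).card m (A.colInit l m).card := by
  obtain ⟨T, hT⟩ : ∃ T : SYT A, ∀ c ∈ A.cells, ∀ c' ∈ A.cells,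
      (T.entry c < T.entry c' ↔ layerKey A l c < layerKey A l c') :=
    ⟨ofKey A (layerKey A l) (layerKey_injOn A l)
      (fun c hc c' hc' h => layerKey_lt A l hc hc' h), fun c hc c' hc' => by
        rw [← not_le, ← not_le, ofKey_entry_le_iff _ _ _ _ hc' hc]⟩
  have hL : ∀ c ∈ A.cells, (T.entry c ≤ (A.rowInit l).card ↔ c.2 < A.mu.rowLen c.1 + l) := by
    intro c hc
    rw [T.entry_le_card_iff (S := A.rowInit l) (filter_subset _ _) ?_ hc]
    · simp [SkewShape.rowInit, hc]
    · intro d hd d' hd' hle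
      simp only [SkewShape.rowInit, mem_filter] at hd ⊢
      refine ⟨hd', ?_⟩
      by_contra! hcon
      exact hle.not_gt ((hT _ hd.1 _ hd').2 (layerKey_lt_of_lt_of_le A l hd.2 hcon))
  choose! p hpA hp using fun k (hk : k ∈ Icc 1 A.size) => T.exists_entry_eq hk
  have hLcard : (A.rowInit l).card ≤ A.size := card_filter_le _ _
  refine ⟨T, fun k hk => ?_, fun m k hk => ?_⟩
  · rw [mem_Icc] at hk
    have hpL : ∀ x, 1 ≤ x → x ≤ k → (p x).2 < A.mu.rowLen (p x).1 + l := fun x h1 h2 => by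
      have hx : x ∈ Icc 1 A.size := mem_Icc.2 ⟨h1, by omega⟩
      rw [← hL _ (hpA _ hx), hp _ hx]
      omega
    have hstep : ∀ x ∈ Ico 1 k, (p x).2 - A.mu.rowLen (p x).1 <
          (p (x + 1)).2 - A.mu.rowLen (p (x + 1)).1 ∨
        (p x).2 - A.mu.rowLen (p x).1 = (p (x + 1)).2 - A.mu.rowLen (p (x + 1)).1 ∧
          x ∈ T.descentSet := by
      intro x hx
      rw [mem_Ico] at hx
      have hx1 : x ∈ Icc 1 A.size := mem_Icc.2 ⟨by omega, by omega⟩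
      have hx2 : x + 1 ∈ Icc 1 A.size := mem_Icc.2 ⟨by omega, by omega⟩
      have h1 := T.mem_descentSet_iff (hpA _ hx1) (hpA _ hx2) (by rw [hp _ hx1, hp _ hx2])
      have h2 := (hT _ (hpA _ hx1) _ (hpA _ hx2)).1 (by rw [hp _ hx1, hp _ hx2]; omega)
      rw [hp _ hx1] at h1
      rwa [layerKey_lt_iff_of_lt_of_lt A l (hpL _ (by omega) (by omega))
        (hpL _ (by omega) (by omega)), ← h1] at h2
    refine card_lt_of_forall_lt_succ (g := fun x => (p x).2 - A.mu.rowLen (p x).1)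
      sdiff_subset (fun x hx => ?_) (fun x hx => ?_) hk.1 ?_
    · rcases hstep x hx with h | h
      exacts [h.le, h.1.le]
    · rw [mem_sdiff] at hx
      exact (hstep x hx.1).resolve_right fun h => hx.2 h.2
    · have h1 := hpL k hk.1 le_rfl
      have h2 := (A.mem_cells_iff _ _).1 (hpA k (mem_Icc.2 ⟨by omega, by omega⟩))
      omega
  · have hsize := A.rects_add_card m l
    rw [mem_Icc] at hk
    have hdisj : Disjoint (A.rowInit l) (A.colInit l m) := by
      rw [disjoint_left]
      intro c hc hc'
      simp only [SkewShape.rowInit, SkewShape.colInit, mem_filter] at hc hc'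
      omega
    have hK : ∀ c ∈ A.cells, T.entry c ≤ (A.rowInit l).card + (A.colInit l m).card →
        A.mu.rowLen c.1 + l ≤ c.2 → A.depth l c < m := by
      intro c hc hle hlc
      rw [← card_union_of_disjoint hdisj,
        T.entry_le_card_iff (S := A.rowInit l ∪ A.colInit l m)
          (union_subset (filter_subset _ _) (filter_subset _ _)) ?_ hc,
        mem_union, SkewShape.mem_colInit_iff] at hle
      · simp only [SkewShape.rowInit, mem_filter] at hle
        omega
      · intro d hd d' hd' hdle
        simp only [SkewShape.rowInit, mem_union, mem_filter, SkewShape.mem_colInit_iff] at hd ⊢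
        rcases lt_or_ge d'.2 (A.mu.rowLen d'.1 + l) with hl' | hl'
        · exact Or.inl ⟨hd', hl'⟩
        · refine Or.inr ⟨hd', hl', ?_⟩
          have hdA : d ∈ A.cells := hd.elim And.left And.left
          have h1 := mt (hT _ hdA _ hd').2 hdle.not_gt
          rcases hd with hd | hd
          · exact absurd (layerKey_lt_of_lt_of_le A l hd.2 hl') h1
          · rw [layerKey_lt_iff_of_le_of_le A l hd.2.1 hl'] at h1
            omega
    have hpL : ∀ x, (A.rowInit l).card + 1 ≤ x → x ≤ k →
        A.mu.rowLen (p x).1 + l ≤ (p x).2 := fun x h1 h2 => by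
      have hx : x ∈ Icc 1 A.size := mem_Icc.2 ⟨by omega, by omega⟩
      rw [← not_lt, ← hL _ (hpA _ hx), hp _ hx]
      omega
    have hstep : ∀ x ∈ Ico ((A.rowInit l).card + 1) k,
        A.depth l (p x) < A.depth l (p (x + 1)) ∨
        A.depth l (p x) = A.depth l (p (x + 1)) ∧ x ∉ T.descentSet := by
      intro x hx
      rw [mem_Ico] at hx
      have hx1 : x ∈ Icc 1 A.size := mem_Icc.2 ⟨by omega, by omega⟩
      have hx2 : x + 1 ∈ Icc 1 A.size := mem_Icc.2 ⟨by omega, by omega⟩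
      have h1 := T.mem_descentSet_iff (hpA _ hx1) (hpA _ hx2) (by rw [hp _ hx1, hp _ hx2])
      have h2 := (hT _ (hpA _ hx1) _ (hpA _ hx2)).1 (by rw [hp _ hx1, hp _ hx2]; omega)
      have h3 := hpL x hx.1 (by omega)
      rw [hp _ hx1] at h1
      rw [layerKey_lt_iff_of_le_of_le A l h3 (hpL _ (by omega) (by omega))] at h2
      refine h2.imp_right fun h => ⟨h.1, fun hD => ?_⟩
      exact (A.depth_lt (h1.1 hD) h.2.le h3).ne h.1
    refine card_lt_of_forall_lt_succ (g := fun x => A.depth l (p x))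
      inter_subset_left (fun x hx => ?_) (fun x hx => ?_) hk.1 ?_
    · rcases hstep x hx with h | h
      exacts [h.le, h.1.le]
    · rw [mem_inter] at hx
      exact (hstep x hx.1).resolve_right fun h => h.2 hx.2
    · have hkA : k ∈ Icc 1 A.size := mem_Icc.2 ⟨by omega, by omega⟩
      exact hK _ (hpA k hkA) (by rw [hp k hkA]; exact hk.2) (hpL k hk.1 le_rfl)

end SYT

theorem zipWith_sub_injective {a : ℕ} {l l' : List ℕ} (h : (a :: l).Pairwise (· ≤ ·))
    (h' : (a :: l').Pairwise (· ≤ ·))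
    (heq : List.zipWith (fun x y => x - y) l (a :: l) =
      List.zipWith (fun x y => x - y) l' (a :: l')) : l = l' := by
  induction l generalizing a l' with
  | nil => cases l' with
    | nil => rfl
    | cons x' l' => simp at heq
  | cons x l ih => cases l' with
    | nil => simp at heq
    | cons x' l' =>
      simp only [List.zipWith_cons_cons, List.cons.injEq] at heq
      have h1 := List.rel_of_pairwise_cons h (List.mem_cons_self)
      have h2 := List.rel_of_pairwise_cons h' (List.mem_cons_self)
      obtain rfl : x = x' := by omega
      rw [ih h.of_cons h'.of_cons heq.2]

theorem compOfSet_injective {n n' : ℕ} {D D' : Finset ℕ} (hD : D ⊆ Ico 1 n)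
    (hD' : D' ⊆ Ico 1 n') (h : compOfSet n D = compOfSet n' D') : n = n' ∧ D = D' := by
  have hne : ∀ {n : ℕ} {D : Finset ℕ}, n ≠ 0 → compOfSet n D ≠ [] := by
    intro n D hn
    rw [compOfSet, if_neg hn, ← List.length_pos_iff]
    simp
  have hsorted : ∀ {n : ℕ} {D : Finset ℕ}, D ⊆ Ico 1 n →
      (0 :: (D.sort (· ≤ ·) ++ [n])).Pairwise (· ≤ ·) := by
    intro n D hD
    simp only [List.pairwise_cons, List.pairwise_append, List.mem_append, mem_sort]
    refine ⟨by simp, pairwise_sort D _, by simp, fun x hx y hy => ?_⟩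
    have := mem_Ico.1 (hD hx)
    simp only [List.mem_singleton] at hy
    omega
  by_cases hn : n = 0
  · by_cases hn' : n' = 0
    · subst hn hn'
      simp only [Ico_eq_empty_of_le zero_le_one, subset_empty] at hD hD'
      exact ⟨rfl, hD.trans hD'.symm⟩
    · subst hn
      exact absurd h.symm (hne hn')
  · by_cases hn' : n' = 0
    · subst hn'
      exact absurd h (hne hn)
    · rw [compOfSet, compOfSet, if_neg hn, if_neg hn'] at h
      have h1 := zipWith_sub_injective (hsorted hD) (hsorted hD') h
      obtain ⟨h2, h3⟩ := List.append_inj' h1 rfl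
      refine ⟨by simpa using h3, ?_⟩
      rw [← sort_toFinset D (· ≤ ·), h2, sort_toFinset]

theorem size_eq_and_exists_descentSet_eq {A B : SkewShape} (h : Fsupp A ⊆ Fsupp B) (T : SYT A) :
    A.size = B.size ∧ ∃ T' : SYT B, T.descentSet = T'.descentSet := by
  obtain ⟨T', hT'⟩ := h ⟨T, rfl⟩
  obtain ⟨h1, h2⟩ := compOfSet_injective (filter_subset _ _) (filter_subset _ _) hT'
  exact ⟨h1.symm, T', h2.symm⟩

theorem card_rowInit_le {A B : SkewShape} (h : Fsupp A ⊆ Fsupp B) (l : ℕ) :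
    (A.rowInit l).card ≤ (B.rowInit l).card := by
  obtain ⟨T, hT, -⟩ := SYT.exists_layered A l
  obtain ⟨hs, T', hT'⟩ := size_eq_and_exists_descentSet_eq h T
  rw [hT'] at hT
  exact T'.le_card_rowInit (hs ▸ card_filter_le _ _) hT

theorem card_colInit_le {A B : SkewShape} (h : Fsupp A ⊆ Fsupp B) (l m : ℕ)
    (hl : (A.rowInit l).card = (B.rowInit l).card) :
    (A.colInit l m).card ≤ (B.colInit l m).card := by
  obtain ⟨T, hT, hT₂⟩ := SYT.exists_layered A l
  obtain ⟨hs, T', hT'⟩ := size_eq_and_exists_descentSet_eq h T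
  have hT₂ := hT₂ m
  have := A.rects_add_card m l
  rw [hT', hl] at hT hT₂
  exact T'.le_card_colInit (by omega) hT hT₂

theorem rects_eq_of_Fsupp_eq {A B : SkewShape} (h : Fsupp A = Fsupp B) (k l : ℕ) (hk : 1 ≤ k)
    (hl : 1 ≤ l) : rects A.cells k l = rects B.cells k l := by
  obtain ⟨k, rfl⟩ := Nat.exists_eq_add_of_le' hk
  obtain ⟨l, rfl⟩ := Nat.exists_eq_add_of_le' hl
  obtain ⟨T, -⟩ := SYT.exists_layered A l
  have h1 := (size_eq_and_exists_descentSet_eq h.le T).1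
  have h2 := (card_rowInit_le h.le l).antisymm (card_rowInit_le h.ge l)
  have h3 := (card_colInit_le h.le l k h2).antisymm (card_colInit_le h.ge l k h2.symm)
  have h4 := A.rects_add_card k l
  have h5 := B.rects_add_card k l
  omega

theorem stmt2 (A B : SkewShape) (h : Fsupp A = Fsupp B) :
    (∀ k, 1 ≤ k → rowsk A.cells k = rowsk B.cells k) ∧
    (∀ l, 1 ≤ l → colsk A.cells l = colsk B.cells l) ∧
    (∀ k l, 1 ≤ k → 1 ≤ l → rects A.cells k l = rects B.cells k l) := by
  have hr := rects_eq_of_Fsupp_eq h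
  refine ⟨SkewShape.rowsk_eq_of_rects_eq hr, fun l hl => ?_, hr⟩
  rw [← SkewShape.rowsk_transpose, ← SkewShape.rowsk_transpose]
  refine SkewShape.rowsk_eq_of_rects_eq (fun k l hk hl => ?_) l hl
  rw [SkewShape.rects_transpose, SkewShape.rects_transpose, hr l k hl hk]

end SkewPaper
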